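/- Let n ≥ 3, m ≥ 2, and let u be a smooth solution of Δᵐu = 0 in Ω\{x₀} ⊂ ℝⁿ with |u(x)| = o(|x - x₀|^{2m-n}) as |x - x₀| → 0. Then u has a removable singularity at x₀. -/

import Mathlib

open Metric Filter MeasureTheory Asymptotics
open scoped Topology

/-- Euclidean space ℝⁿ. -/
abbrev E (n : ℕ) := EuclideanSpace ℝ (Fin n)

/-- The Laplacian of a function on ℝⁿ. -/
noncomputable def lap {n : ℕ} (f : E n → ℝ) : E n → ℝ := fun x =>
  ∑ i : Fin n, fderiv ℝ (fun y => fderiv ℝ f y (EuclideanSpace.single i 1)) x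
    (EuclideanSpace.single i 1)

lemma lap_smooth_param {n : ℕ} {G : ℝ → E n → ℝ}
    (hG : ContDiff ℝ (⊤ : ℕ∞) (fun p : ℝ × E n => G p.1 p.2)) :
    ContDiff ℝ (⊤ : ℕ∞) (fun p : ℝ × E n => lap (G p.1) p.2) := by
  unfold lap
  refine ContDiff.sum fun i _ => ?_
  have h1 : ContDiff ℝ (⊤ : ℕ∞)
      (fun p : ℝ × E n => fderiv ℝ (G p.1) p.2 (EuclideanSpace.single i 1)) := by
    refine ContDiff.clm_apply ?_ contDiff_const
    refine ContDiff.fderiv (f := fun p : ℝ × E n => G p.1) (m := (⊤ : ℕ∞)) ?_ contDiff_snd (by simp)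
    exact hG.comp ((contDiff_fst.comp contDiff_fst).prodMk contDiff_snd)
  refine ContDiff.clm_apply ?_ contDiff_const
  refine ContDiff.fderiv (f := fun (p : ℝ × E n) y => fderiv ℝ (G p.1) y (EuclideanSpace.single i 1))
    (m := (⊤ : ℕ∞)) ?_ contDiff_snd (by simp)
  exact h1.comp ((contDiff_fst.comp contDiff_fst).prodMk contDiff_snd)

lemma lap_iter_smooth_param {n : ℕ} (m : ℕ) {G : ℝ → E n → ℝ}
    (hG : ContDiff ℝ (⊤ : ℕ∞) (fun p : ℝ × E n => G p.1 p.2)) :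
    ContDiff ℝ (⊤ : ℕ∞) (fun p : ℝ × E n => lap^[m] (G p.1) p.2) := by
  induction m with
  | zero => simpa using hG
  | succ k ih =>
    simp only [Function.iterate_succ_apply']
    exact lap_smooth_param (G := fun t => lap^[k] (G t)) ih

lemma lap_iter_smooth {n : ℕ} (m : ℕ) {f : E n → ℝ} (hf : ContDiff ℝ (⊤ : ℕ∞) f) :
    ContDiff ℝ (⊤ : ℕ∞) (lap^[m] f) := by
  have := lap_iter_smooth_param m (G := fun _ => f) (hf.comp contDiff_snd)
  exact this.comp (contDiff_const (c := (0:ℝ)) |>.prodMk contDiff_id)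

lemma lap_congr {n : ℕ} {f g : E n → ℝ} {x : E n} (h : f =ᶠ[𝓝 x] g) :
    lap f =ᶠ[𝓝 x] lap g := by
  have h1 : ∀ᶠ y in 𝓝 x, f =ᶠ[𝓝 y] g := h.eventually_nhds
  filter_upwards [h1.eventually_nhds] with y hy
  unfold lap
  refine Finset.sum_congr rfl fun i _ => ?_
  have : (fun y => fderiv ℝ f y (EuclideanSpace.single i 1)) =ᶠ[𝓝 y]
      fun y => fderiv ℝ g y (EuclideanSpace.single i 1) := by
    filter_upwards [hy] with z hz
    rw [hz.fderiv_eq]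
  rw [this.fderiv_eq]

lemma lap_iter_congr {n : ℕ} (m : ℕ) {f g : E n → ℝ} {x : E n} (h : f =ᶠ[𝓝 x] g) :
    lap^[m] f =ᶠ[𝓝 x] lap^[m] g := by
  induction m with
  | zero => simpa using h
  | succ k ih =>
    simp only [Function.iterate_succ_apply']
    exact lap_congr ih

lemma lap_zero {n : ℕ} : lap (fun _ : E n => (0:ℝ)) = fun _ => 0 := by
  funext x; simp [lap]

lemma lap_iter_zero {n : ℕ} (m : ℕ) : lap^[m] (fun _ : E n => (0:ℝ)) = fun _ => 0 := by
  induction m with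
  | zero => rfl
  | succ k ih => rw [Function.iterate_succ_apply', ih, lap_zero]

lemma lap_iter_eq_zero {n : ℕ} (m : ℕ) {f : E n → ℝ} {x : E n} (h : f =ᶠ[𝓝 x] fun _ => 0) :
    lap^[m] f =ᶠ[𝓝 x] fun _ => 0 := by
  have := lap_iter_congr m h
  rwa [lap_iter_zero] at this

lemma lap_iter_eq_zero_of_notMem {n : ℕ} (m : ℕ) {f : E n → ℝ} {x : E n} (h : x ∉ tsupport f) :
    lap^[m] f x = 0 :=
  (lap_iter_eq_zero m (notMem_tsupport_iff_eventuallyEq.mp h)).eq_of_nhds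

lemma lap_iter_compact {n : ℕ} (m : ℕ) {f : E n → ℝ} (h : HasCompactSupport f) :
    HasCompactSupport (lap^[m] f) :=
  HasCompactSupport.intro h fun _ hx => lap_iter_eq_zero_of_notMem m hx

lemma sm_d {n : ℕ} {f : E n → ℝ} (hf : ContDiff ℝ (⊤ : ℕ∞) f) (v : E n) :
    ContDiff ℝ (⊤ : ℕ∞) (fun y => fderiv ℝ f y v) :=
  (hf.fderiv_right (m := (⊤ : ℕ∞)) (by simp)).clm_apply contDiff_const

lemma sm_diff {n : ℕ} {f : E n → ℝ} (hf : ContDiff ℝ (⊤ : ℕ∞) f) : Differentiable ℝ f :=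
  hf.differentiable (by simp)

lemma lap_sub {n : ℕ} {f g : E n → ℝ} (hf : ContDiff ℝ (⊤ : ℕ∞) f) (hg : ContDiff ℝ (⊤ : ℕ∞) g) :
    lap (fun x => f x - g x) = fun x => lap f x - lap g x := by
  funext x
  unfold lap
  rw [← Finset.sum_sub_distrib]
  refine Finset.sum_congr rfl fun i _ => ?_
  have : (fun y => fderiv ℝ (fun x => f x - g x) y (EuclideanSpace.single i 1)) =
      fun y => fderiv ℝ f y (EuclideanSpace.single i 1) - fderiv ℝ g y (EuclideanSpace.single i 1) := by
    funext y
    rw [fderiv_fun_sub (sm_diff hf y) (sm_diff hg y)]; rfl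
  rw [this, fderiv_fun_sub (sm_diff (sm_d hf _) x) (sm_diff (sm_d hg _) x)]; rfl

lemma lap_iter_sub {n : ℕ} (m : ℕ) {f g : E n → ℝ} (hf : ContDiff ℝ (⊤ : ℕ∞) f)
    (hg : ContDiff ℝ (⊤ : ℕ∞) g) :
    lap^[m] (fun x => f x - g x) = fun x => lap^[m] f x - lap^[m] g x := by
  induction m with
  | zero => rfl
  | succ k ih =>
    simp only [Function.iterate_succ_apply', ih]
    exact lap_sub (lap_iter_smooth k hf) (lap_iter_smooth k hg)

lemma lap_const_mul {n : ℕ} (c : ℝ) {f : E n → ℝ} (hf : ContDiff ℝ (⊤ : ℕ∞) f) :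
    lap (fun x => c * f x) = fun x => c * lap f x := by
  funext x
  unfold lap
  rw [Finset.mul_sum]
  refine Finset.sum_congr rfl fun i _ => ?_
  have : (fun y => fderiv ℝ (fun x => c * f x) y (EuclideanSpace.single i 1)) =
      fun y => c * fderiv ℝ f y (EuclideanSpace.single i 1) := by
    funext y
    rw [fderiv_const_mul (sm_diff hf y)]; rfl
  rw [this, fderiv_const_mul (sm_diff (sm_d hf _) x)]; rfl

lemma lap_scale {n : ℕ} (c : ℝ) (x₀ : E n) {f : E n → ℝ} (hf : ContDiff ℝ (⊤ : ℕ∞) f) :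
    lap (fun x => f (c • (x - x₀))) = fun x => c ^ 2 * lap f (c • (x - x₀)) := by
  have key : ∀ {g : E n → ℝ}, ContDiff ℝ (⊤ : ℕ∞) g → ∀ y v,
      fderiv ℝ (fun x => g (c • (x - x₀))) y v = c * fderiv ℝ g (c • (y - x₀)) v := by
    intro g hg y v
    have h1 : HasFDerivAt (fun x : E n => c • (x - x₀)) (c • ContinuousLinearMap.id ℝ (E n)) y :=
      ((hasFDerivAt_id y).sub_const x₀).const_smul c
    have h2 := ((sm_diff hg (c • (y - x₀))).hasFDerivAt).comp y h1
    have h3 : fderiv ℝ (fun x => g (c • (x - x₀))) y = _ := h2.fderiv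
    rw [h3]; simp
  funext x
  unfold lap
  rw [Finset.mul_sum]
  refine Finset.sum_congr rfl fun i _ => ?_
  simp_rw [key hf]
  have hs : ContDiff ℝ (⊤ : ℕ∞) (fun y : E n => c • (y - x₀)) := by fun_prop
  have hd : ContDiff ℝ (⊤ : ℕ∞)
      (fun y : E n => fderiv ℝ f (c • (y - x₀)) (EuclideanSpace.single i 1)) :=
    (sm_d hf (EuclideanSpace.single i 1)).comp hs
  rw [fderiv_const_mul (sm_diff hd x)]
  have := key (sm_d hf (EuclideanSpace.single i 1)) x (EuclideanSpace.single i 1)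
  simp only [smul_apply, smul_eq_mul]
  rw [this]; ring

lemma lap_iter_scale {n : ℕ} (m : ℕ) (c : ℝ) (x₀ : E n) {f : E n → ℝ}
    (hf : ContDiff ℝ (⊤ : ℕ∞) f) :
    lap^[m] (fun x => f (c • (x - x₀))) = fun x => c ^ (2 * m) * lap^[m] f (c • (x - x₀)) := by
  induction m with
  | zero => simp
  | succ k ih =>
    have hs : ContDiff ℝ (⊤ : ℕ∞) (fun y : E n => c • (y - x₀)) := by fun_prop
    simp only [Function.iterate_succ_apply', ih]
    have hd : ContDiff ℝ (⊤ : ℕ∞) (fun y : E n => lap^[k] f (c • (y - x₀))) :=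
      (lap_iter_smooth k hf).comp hs
    rw [lap_const_mul _ hd, lap_scale c x₀ (lap_iter_smooth k hf)]
    funext x; ring

/-- symmetry of the Laplacian -/
lemma integral_d {n : ℕ} {f g : E n → ℝ} (hf : ContDiff ℝ (⊤ : ℕ∞) f) (hc : HasCompactSupport f)
    (hg : ContDiff ℝ (⊤ : ℕ∞) g) (v : E n) :
    ∫ x, f x * fderiv ℝ g x v = - ∫ x, fderiv ℝ f x v * g x := by
  have hdc : HasCompactSupport (fun x => fderiv ℝ f x v) := hc.fderiv_apply ℝ v
  refine integral_mul_fderiv_eq_neg_fderiv_mul_of_integrable ?_ ?_ ?_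
    (fun x _ => sm_diff hf x) (fun x _ => sm_diff hg x)
  · exact ((sm_d hf v).continuous.mul hg.continuous).integrable_of_hasCompactSupport hdc.mul_right
  · exact (hf.continuous.mul (sm_d hg v).continuous).integrable_of_hasCompactSupport hc.mul_right
  · exact (hf.continuous.mul hg.continuous).integrable_of_hasCompactSupport hc.mul_right

lemma integral_lap {n : ℕ} {f g : E n → ℝ} (hf : ContDiff ℝ (⊤ : ℕ∞) f) (hc : HasCompactSupport f)
    (hg : ContDiff ℝ (⊤ : ℕ∞) g) :
    ∫ x, f x * lap g x = ∫ x, lap f x * g x := by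
  unfold lap
  simp_rw [Finset.mul_sum, Finset.sum_mul]
  have hdc : ∀ v, HasCompactSupport (fun x => fderiv ℝ f x v) := fun v => hc.fderiv_apply ℝ v
  rw [integral_finsetSum, integral_finsetSum]
  · refine Finset.sum_congr rfl fun i _ => ?_
    rw [integral_d hf hc (sm_d hg _)]
    have h2 := integral_d (sm_d hf (EuclideanSpace.single i 1)) (hdc _) hg (EuclideanSpace.single i 1)
    rw [h2, neg_neg]
  · intro i _
    exact ((sm_d (sm_d hf _) _).continuous.mul hg.continuous).integrable_of_hasCompactSupport
      (((hdc _).fderiv_apply ℝ _).mul_right)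
  · intro i _
    exact (hf.continuous.mul (sm_d (sm_d hg _) _).continuous).integrable_of_hasCompactSupport
      hc.mul_right

lemma integral_lap_iter {n : ℕ} (m : ℕ) {f g : E n → ℝ} (hf : ContDiff ℝ (⊤ : ℕ∞) f)
    (hc : HasCompactSupport f) (hg : ContDiff ℝ (⊤ : ℕ∞) g) :
    ∫ x, f x * lap^[m] g x = ∫ x, lap^[m] f x * g x := by
  induction m generalizing g with
  | zero => rfl
  | succ k ih =>
    have hl : ContDiff ℝ (⊤ : ℕ∞) (lap g) := lap_iter_smooth 1 hg
    rw [Function.iterate_succ_apply, ih hl,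
      integral_lap (lap_iter_smooth k hf) (lap_iter_compact k hc) hg]
    simp only [Function.iterate_succ_apply']

/-- scaled cutoff estimate -/
lemma cutoff_bound {n : ℕ} (m : ℕ) (x₀ : E n) {η φ : E n → ℝ} (hη : ContDiff ℝ (⊤ : ℕ∞) η)
    (hc : HasCompactSupport η) (hφ : ContDiff ℝ (⊤ : ℕ∞) φ) :
    ∃ C, 0 ≤ C ∧ ∀ ε : ℝ, 0 < ε → ε ≤ 1 → ∀ x,
      |lap^[m] (fun x => η (ε⁻¹ • (x - x₀)) * φ x) x| ≤ C * (ε⁻¹) ^ (2 * m) := by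
  let G : ℝ → E n → ℝ := fun t y => η y * φ (x₀ + t • y)
  have hG : ContDiff ℝ (⊤ : ℕ∞) (fun p : ℝ × E n => G p.1 p.2) := by
    have h1 : ContDiff ℝ (⊤ : ℕ∞) (fun p : ℝ × E n => x₀ + p.1 • p.2) := by fun_prop
    exact (hη.comp contDiff_snd).mul (hφ.comp h1)
  have hcont := (lap_iter_smooth_param m hG).continuous
  have hK : IsCompact (Set.Icc (0:ℝ) 1 ×ˢ tsupport η) := isCompact_Icc.prod hc
  obtain ⟨C, hC⟩ := hK.exists_bound_of_continuousOn hcont.continuousOn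
  refine ⟨max C 0, le_max_right _ _, fun ε h0 h1 x => ?_⟩
  have hGe : ContDiff ℝ (⊤ : ℕ∞) (G ε) := hG.comp (contDiff_const.prodMk contDiff_id)
  have e : (fun x => η (ε⁻¹ • (x - x₀)) * φ x) = fun x => G ε (ε⁻¹ • (x - x₀)) := by
    funext x
    simp only [G]
    rw [smul_smul, mul_inv_cancel₀ h0.ne', one_smul, add_sub_cancel]
  rw [e, lap_iter_scale m _ _ hGe, abs_mul, abs_of_nonneg (by positivity), mul_comm]
  gcongr
  by_cases hy : ε⁻¹ • (x - x₀) ∈ tsupport η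
  · exact (hC (ε, ε⁻¹ • (x - x₀)) ⟨⟨h0.le, h1⟩, hy⟩).trans (le_max_left _ _)
  · rw [lap_iter_eq_zero_of_notMem]
    · simp
    · intro h
      exact hy (tsupport_mul_subset_left h)

lemma pow_int {n m : ℕ} (hn : 1 ≤ n) (hm : 1 ≤ m) (x₀ : E n) :
    ∃ K : ℝ, 0 ≤ K ∧ ∀ R : ℝ, 0 < R →
      IntegrableOn (fun x : E n => ‖x - x₀‖ ^ (2 * (m : ℝ) - n)) (ball x₀ R) ∧
      ∫ x in ball x₀ R, ‖x - x₀‖ ^ (2 * (m : ℝ) - n) = K * R ^ (2 * m) := by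
  have : Nonempty (Fin n) := ⟨⟨0, hn⟩⟩
  have : Nontrivial (E n) := inferInstance
  let a : ℝ := 2 * (m : ℝ) - n
  refine ⟨n * (volume.real (ball (0 : E n) 1) * (1 / (2 * m))), by positivity, fun R hR => ?_⟩
  let f : ℝ → ℝ := (Set.Iio R).indicator (fun y => y ^ a)
  have hdim : Module.finrank ℝ (E n) = n := by simp
  have hm' : (-1 : ℝ) < 2 * m - 1 := by
    have : (1 : ℝ) ≤ m := by exact_mod_cast hm
    linarith
  have e1 : ∀ y ∈ Set.Ioi (0 : ℝ), y ^ (Module.finrank ℝ (E n) - 1) • f y =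
      (Set.Ioo 0 R).indicator (fun y => y ^ (2 * (m : ℝ) - 1)) y := by
    intro y hy
    have hy0 : (0 : ℝ) < y := hy
    by_cases hyR : y < R
    · rw [Set.indicator_of_mem (show y ∈ Set.Ioo 0 R from ⟨hy0, hyR⟩)]
      simp only [f]
      rw [Set.indicator_of_mem (show y ∈ Set.Iio R from hyR), smul_eq_mul, hdim,
        ← Real.rpow_natCast, ← Real.rpow_add hy0]
      congr 1
      rw [Nat.cast_sub hn]; simp only [a]; push_cast; ring
    · rw [Set.indicator_of_notMem (fun h => hyR h.2)]
      simp only [f]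
      rw [Set.indicator_of_notMem (show y ∉ Set.Iio R from hyR), smul_zero]
  have hint : IntegrableOn (fun y : ℝ => y ^ (2 * (m : ℝ) - 1)) (Set.Ioo 0 R) := by
    have := intervalIntegral.intervalIntegrable_rpow' (a := 0) (b := R) hm'
    rw [intervalIntegrable_iff_integrableOn_Ioo_of_le hR.le] at this
    exact this
  have hI : Integrable (fun x : E n => f ‖x‖) := by
    rw [integrable_fun_norm_addHaar volume, integrableOn_congr_fun e1 measurableSet_Ioi]
    exact (hint.integrable_indicator measurableSet_Ioo).integrableOn
  have e2 : (fun x : E n => f ‖x - x₀‖) =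
      (ball x₀ R).indicator (fun x => ‖x - x₀‖ ^ (2 * (m : ℝ) - n)) := by
    funext x
    simp only [f, Set.indicator, mem_ball, dist_eq_norm, Set.mem_Iio, a]
  constructor
  · rw [← integrable_indicator_iff measurableSet_ball, ← e2]
    exact hI.comp_sub_right x₀
  · rw [← integral_indicator measurableSet_ball, ← e2,
      integral_sub_right_eq_self (fun x : E n => f ‖x‖) x₀, integral_fun_norm_addHaar,
      setIntegral_congr_fun measurableSet_Ioi e1, setIntegral_indicator measurableSet_Ioo]
    have : Set.Ioi (0:ℝ) ∩ Set.Ioo 0 R = Set.Ioo 0 R := by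
      ext y; simp only [Set.mem_inter_iff, Set.mem_Ioi, Set.mem_Ioo]; tauto
    rw [this, ← integral_Ioc_eq_integral_Ioo, ← intervalIntegral.integral_of_le hR.le,
      integral_rpow (Or.inl hm'), hdim]
    have e3 : 2 * (m : ℝ) - 1 + 1 = ((2 * m : ℕ) : ℝ) := by push_cast; ring
    rw [e3, Real.rpow_natCast, Real.rpow_natCast]
    simp only [smul_eq_mul, nsmul_eq_mul]
    rw [zero_pow (by omega)]
    push_cast
    ring

lemma w_bound {n m : ℕ} {x₀ : E n} {w : E n → ℝ}
    (ho : w =o[𝓝[≠] x₀] fun x => ‖x - x₀‖ ^ (2 * (m : ℝ) - n)) {c : ℝ} (hc : 0 < c) :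
    ∃ ρ > 0, ∀ x ∈ ball x₀ ρ, x ≠ x₀ → |w x| ≤ c * ‖x - x₀‖ ^ (2 * (m : ℝ) - n) := by
  have h := ho.def hc
  rw [eventually_nhdsWithin_iff, Metric.eventually_nhds_iff] at h
  obtain ⟨ρ, hρ, h⟩ := h
  refine ⟨ρ, hρ, fun x hx hne => ?_⟩
  have := h hx hne
  rwa [Real.norm_eq_abs, Real.norm_of_nonneg (by positivity)] at this

lemma w_meas {n : ℕ} (hn : 1 ≤ n) {x₀ : E n} {w : E n → ℝ} (hw : ContinuousOn w {x₀}ᶜ) :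
    AEStronglyMeasurable w volume := by
  have : Nonempty (Fin n) := ⟨⟨0, hn⟩⟩
  have := hw.aestronglyMeasurable (μ := volume) (measurableSet_singleton x₀).compl
  rwa [restrict_compl_singleton] at this

lemma w_integrable {n m : ℕ} (hn : 1 ≤ n) (hm : 1 ≤ m) {x₀ : E n} {w : E n → ℝ}
    (hw : ContinuousOn w {x₀}ᶜ) (hc : HasCompactSupport w)
    (ho : w =o[𝓝[≠] x₀] fun x => ‖x - x₀‖ ^ (2 * (m : ℝ) - n)) : Integrable w := by
  have : Nonempty (Fin n) := ⟨⟨0, hn⟩⟩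
  obtain ⟨K, hK, hpow⟩ := pow_int hn hm x₀
  obtain ⟨ρ, hρ, hb⟩ := w_bound ho one_pos
  have hne : ∀ᵐ x : E n, x ≠ x₀ := by
    simp [ae_iff]
  have h1 : IntegrableOn w (ball x₀ ρ) := by
    refine Integrable.mono' (hpow ρ hρ).1 (w_meas hn hw).restrict ?_
    filter_upwards [ae_restrict_mem measurableSet_ball, ae_restrict_of_ae hne] with x hx hx'
    simpa using hb x hx hx'
  have h2 : IntegrableOn w (tsupport w \ ball x₀ ρ) := by
    refine ContinuousOn.integrableOn_compact (hc.diff isOpen_ball) (hw.mono ?_)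
    intro x hx h
    rw [Set.mem_singleton_iff] at h
    exact hx.2 (h ▸ mem_ball_self hρ)
  rw [← integrableOn_iff_integrable_of_support_subset
    (s := ball x₀ ρ ∪ (tsupport w \ ball x₀ ρ))]
  · exact h1.union h2
  · intro x hx
    by_cases h : x ∈ ball x₀ ρ
    · exact Or.inl h
    · exact Or.inr ⟨subset_tsupport _ hx, h⟩

lemma w_mul_integrable {n : ℕ} {w g : E n → ℝ} (hw : Integrable w) (hc : HasCompactSupport w)
    (hg : Continuous g) : Integrable (fun x => w x * g x) := by
  obtain ⟨C, hC⟩ := hc.exists_bound_of_continuousOn hg.continuousOn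
  refine Integrable.mono' (hw.norm.mul_const C) (hw.1.mul hg.aestronglyMeasurable) ?_
  filter_upwards with x
  rw [norm_mul]
  by_cases hx : x ∈ tsupport w
  · gcongr; exact hC x hx
  · rw [image_eq_zero_of_notMem_tsupport hx]; simp

lemma weak {n m : ℕ} (hn : 1 ≤ n) (hm : 1 ≤ m) {x₀ : E n} {w f : E n → ℝ}
    (hw : ContDiffOn ℝ (⊤ : ℕ∞) w {x₀}ᶜ) (hc : HasCompactSupport w)
    (ho : w =o[𝓝[≠] x₀] fun x => ‖x - x₀‖ ^ (2 * (m : ℝ) - n))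
    {r : ℝ} (hr : 0 < r) (hf0 : ∀ x ∈ ball x₀ r, f x = 0)
    (hf : ∀ x, x ≠ x₀ → f x = lap^[m] w x)
    {φ : E n → ℝ} (hφ : ContDiff ℝ (⊤ : ℕ∞) φ) :
    ∫ x, w x * lap^[m] φ x = ∫ x, f x * φ x := by
  have : Nonempty (Fin n) := ⟨⟨0, hn⟩⟩
  have hne : ∀ᵐ x : E n, x ≠ x₀ := by simp [ae_iff]
  have hwi : Integrable w := w_integrable hn hm hw.continuousOn hc ho
  obtain ⟨η, hη, hηc, hη1, hη2⟩ : ∃ η : E n → ℝ, ContDiff ℝ (⊤ : ℕ∞) η ∧ HasCompactSupport η ∧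
      (∀ y, ‖y‖ ≤ 1 → η y = 1) ∧ (∀ y, 2 ≤ ‖y‖ → η y = 0) := by
    let b : ContDiffBump (0 : E n) := ⟨1, 2, by norm_num, by norm_num⟩
    refine ⟨b, b.contDiff, b.hasCompactSupport, fun y hy => b.one_of_mem_closedBall ?_,
      fun y hy => b.zero_of_le_dist ?_⟩
    · simpa [b] using hy
    · simpa [b] using hy
  have hηe : ∀ ε : ℝ, ContDiff ℝ (⊤ : ℕ∞) (fun x => η (ε⁻¹ • (x - x₀))) := fun ε =>
    hη.comp (by fun_prop)
  have hnorm : ∀ ε : ℝ, 0 < ε → ∀ x : E n, ‖ε⁻¹ • (x - x₀)‖ = dist x x₀ / ε := by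
    intro ε hε x
    rw [norm_smul, norm_inv, Real.norm_of_nonneg hε.le, dist_eq_norm]; ring
  -- the value η_ε
  have hone : ∀ ε : ℝ, 0 < ε → ∀ x, dist x x₀ ≤ ε → η (ε⁻¹ • (x - x₀)) = 1 := by
    intro ε hε x hx
    apply hη1; rw [hnorm ε hε, div_le_one hε]; exact hx
  have hzero : ∀ ε : ℝ, 0 < ε → ∀ x, 2 * ε ≤ dist x x₀ → η (ε⁻¹ • (x - x₀)) = 0 := by
    intro ε hε x hx
    apply hη2; rw [hnorm ε hε, le_div_iff₀ hε]; exact hx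
  -- step 1
  have step1 : ∀ ε : ℝ, 0 < ε → 2 * ε ≤ r →
      ∫ x, w x * lap^[m] (fun x => φ x - η (ε⁻¹ • (x - x₀)) * φ x) x = ∫ x, f x * φ x := by
    intro ε hε hεr
    set ψ : E n → ℝ := fun x => φ x - η (ε⁻¹ • (x - x₀)) * φ x with hψdef
    have hψ : ContDiff ℝ (⊤ : ℕ∞) ψ := hφ.sub ((hηe ε).mul hφ)
    have hψ0 : ∀ x ∈ ball x₀ ε, ψ x = 0 := by
      intro x hx
      simp only [hψdef, hone ε hε x (mem_ball.mp hx).le]; ring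
    have hε4 : 0 < ε / 4 := by positivity
    let w' : E n → ℝ := fun x => (1 - η ((ε / 4)⁻¹ • (x - x₀))) * w x
    have hw'0 : w' =ᶠ[𝓝 x₀] fun _ => 0 := by
      filter_upwards [ball_mem_nhds x₀ hε4] with x hx
      simp only [w', hone _ hε4 x (mem_ball.mp hx).le]; ring
    have hw's : ContDiff ℝ (⊤ : ℕ∞) w' := by
      rw [contDiff_iff_contDiffAt]
      intro x
      by_cases hx : x = x₀
      · rw [hx]; exact contDiffAt_const.congr_of_eventuallyEq hw'0
      · exact (contDiff_const.sub (hηe (ε / 4))).contDiffAt.mul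
          (hw.contDiffAt (isOpen_compl_singleton.mem_nhds hx))
    have hw'eq : ∀ x, ε / 2 ≤ dist x x₀ → w' x = w x := by
      intro x hx
      simp only [w', hzero _ hε4 x (by linarith)]; ring
    have hw'c : HasCompactSupport w' := hc.mul_left
    have e1 : ∀ x, w x * lap^[m] ψ x = w' x * lap^[m] ψ x := by
      intro x
      by_cases hx : x ∈ ball x₀ ε
      · have : lap^[m] ψ x = 0 := by
          refine (lap_iter_eq_zero m ?_).eq_of_nhds
          filter_upwards [isOpen_ball.mem_nhds hx] with y hy using hψ0 y hy
        rw [this]; simp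
      · rw [mem_ball, not_lt] at hx
        rw [hw'eq x (by linarith)]
    have e2 : ∀ x, lap^[m] w' x * ψ x = f x * φ x := by
      intro x
      by_cases hx : x ∈ ball x₀ ε
      · rw [hψ0 x hx, hf0 x (ball_subset_ball (by linarith) hx)]; simp
      · rw [mem_ball, not_lt] at hx
        have h1 : lap^[m] w' x = f x := by
          rw [hf x (dist_pos.mp (by linarith))]
          refine (lap_iter_congr m ?_).eq_of_nhds
          have : {y : E n | ε / 2 < dist y x₀} ∈ 𝓝 x :=
            (isOpen_lt continuous_const (continuous_id.dist continuous_const)).mem_nhds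
              (show ε / 2 < dist x x₀ by linarith)
          filter_upwards [this] with y hy using hw'eq y (le_of_lt hy)
        rw [h1]
        by_cases hx2 : 2 * ε ≤ dist x x₀
        · simp only [hψdef, hzero ε hε x hx2]; ring
        · rw [hf0 x (by rw [mem_ball]; linarith)]; simp
    simp_rw [e1]
    rw [integral_lap_iter m hw's hw'c hψ]
    simp_rw [e2]
  obtain ⟨C, hC0, hC⟩ := cutoff_bound m x₀ hη hηc hφ
  obtain ⟨K, hK, hpow⟩ := pow_int hn hm x₀
  have main : ∀ c : ℝ, 0 < c →
      |(∫ x, w x * lap^[m] φ x) - ∫ x, f x * φ x| ≤ c * (C * K * 3 ^ (2 * m)) := by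
    intro c hc0
    obtain ⟨ρ, hρ, hb⟩ := w_bound ho hc0
    obtain ⟨ε, hε, hε1, hεr, hερ⟩ : ∃ ε : ℝ, 0 < ε ∧ ε ≤ 1 ∧ 2 * ε ≤ r ∧ 3 * ε ≤ ρ := by
      refine ⟨min 1 (min (r / 2) (ρ / 3)), by positivity, min_le_left _ _, ?_, ?_⟩
      · have := (min_le_right 1 (min (r / 2) (ρ / 3))).trans (min_le_left _ _); linarith
      · have := (min_le_right 1 (min (r / 2) (ρ / 3))).trans (min_le_right _ _); linarith
    have hs : ContDiff ℝ (⊤ : ℕ∞) (fun x => η (ε⁻¹ • (x - x₀)) * φ x) := (hηe ε).mul hφ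
    have hdiff : (∫ x, w x * lap^[m] φ x) - ∫ x, f x * φ x =
        ∫ x, w x * lap^[m] (fun x => η (ε⁻¹ • (x - x₀)) * φ x) x := by
      rw [← step1 ε hε hεr, lap_iter_sub m hφ hs, ← integral_sub]
      · congr 1; funext x; ring
      · exact w_mul_integrable hwi hc (lap_iter_smooth m hφ).continuous
      · exact w_mul_integrable hwi hc
          ((lap_iter_smooth m hφ).continuous.sub (lap_iter_smooth m hs).continuous)
    rw [hdiff, ← Real.norm_eq_abs]
    have h3 : 0 < 3 * ε := by positivity
    obtain ⟨hpi, hpe⟩ := hpow (3 * ε) h3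
    have hgi : Integrable ((ball x₀ (3 * ε)).indicator
        (fun x => (c * C * (ε⁻¹) ^ (2 * m)) * ‖x - x₀‖ ^ (2 * (m : ℝ) - n))) :=
      IntegrableOn.integrable_indicator (Integrable.const_mul hpi _) measurableSet_ball
    refine (norm_integral_le_of_norm_le hgi ?_).trans ?_
    · filter_upwards [hne] with x hx
      by_cases hxb : x ∈ ball x₀ (3 * ε)
      · rw [Set.indicator_of_mem hxb, norm_mul, Real.norm_eq_abs, Real.norm_eq_abs]
        calc _ ≤ (c * ‖x - x₀‖ ^ (2 * (m : ℝ) - n)) * (C * (ε⁻¹) ^ (2 * m)) :=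
              mul_le_mul (hb x (ball_subset_ball hερ hxb) hx) (hC ε hε hε1 x) (abs_nonneg _)
                (by positivity)
          _ = _ := by ring
      · rw [Set.indicator_of_notMem hxb]
        rw [mem_ball, not_lt] at hxb
        have : lap^[m] (fun x => η (ε⁻¹ • (x - x₀)) * φ x) x = 0 := by
          refine (lap_iter_eq_zero m ?_).eq_of_nhds
          have : {y : E n | 2 * ε < dist y x₀} ∈ 𝓝 x :=
            (isOpen_lt continuous_const (continuous_id.dist continuous_const)).mem_nhds
              (show 2 * ε < dist x x₀ by linarith)
          filter_upwards [this] with y hy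
          rw [hzero ε hε y (le_of_lt hy), zero_mul]
        rw [this]; simp
    · rw [integral_indicator measurableSet_ball, integral_const_mul, hpe, mul_pow, inv_pow]
      have : ε ^ (2 * m) ≠ 0 := by positivity
      apply le_of_eq
      field_simp
  have hM : 0 ≤ C * K * 3 ^ (2 * m) := by positivity
  set M := C * K * 3 ^ (2 * m)
  have hD : |(∫ x, w x * lap^[m] φ x) - ∫ x, f x * φ x| ≤ 0 := by
    refine le_of_forall_pos_le_add fun δ hδ => ?_
    refine (main (δ / (M + 1)) (by positivity)).trans ?_
    rw [zero_add, div_mul_eq_mul_div, div_le_iff₀ (by positivity)]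
    nlinarith
  exact sub_eq_zero.mp (abs_nonpos_iff.mp hD)

/-- The trigonometric test functions. -/
noncomputable def trig {n : ℕ} (ζ : E n) (c : ℝ) : E n → ℝ := fun x => Real.cos (inner ℝ ζ x + c)

lemma trig_smooth {n : ℕ} (ζ : E n) (c : ℝ) : ContDiff ℝ (⊤ : ℕ∞) (trig ζ c) := by
  unfold trig
  exact Real.contDiff_cos.comp ((contDiff_const.inner ℝ contDiff_id).add contDiff_const)

lemma trig_fderiv {n : ℕ} (ζ : E n) (c : ℝ) (x v : E n) :
    fderiv ℝ (trig ζ c) x v = inner ℝ ζ v * trig ζ (c + Real.pi / 2) x := by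
  have h1 : HasFDerivAt (fun x : E n => inner ℝ ζ x + c) (innerSL ℝ ζ) x :=
    ((innerSL ℝ ζ).hasFDerivAt).add_const c
  have h2 : HasFDerivAt (trig ζ c) _ x := h1.cos
  rw [h2.fderiv]
  unfold trig
  rw [← add_assoc, Real.cos_add_pi_div_two]
  simp
  ring

lemma trig_lap {n : ℕ} (ζ : E n) (c : ℝ) :
    lap (trig ζ c) = fun x => (-‖ζ‖ ^ 2) * trig ζ c x := by
  funext x
  unfold lap
  have h : ∀ i : Fin n, fderiv ℝ (fun y => fderiv ℝ (trig ζ c) y (EuclideanSpace.single i 1)) x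
      (EuclideanSpace.single i 1) = - (ζ i) ^ 2 * trig ζ c x := by
    intro i
    simp_rw [trig_fderiv]
    rw [fderiv_const_mul (sm_diff (trig_smooth _ _) x), smul_apply, trig_fderiv]
    have : trig ζ (c + Real.pi / 2 + Real.pi / 2) x = - trig ζ c x := by
      unfold trig
      rw [← Real.cos_add_pi]; congr 1; ring
    rw [this]
    simp [EuclideanSpace.inner_single_right]
    ring
  simp_rw [h]
  rw [← Finset.sum_mul, EuclideanSpace.real_norm_sq_eq, Finset.sum_neg_distrib]

lemma trig_lap_iter {n : ℕ} (m : ℕ) (ζ : E n) (c : ℝ) :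
    lap^[m] (trig ζ c) = fun x => (-‖ζ‖ ^ 2) ^ m * trig ζ c x := by
  induction m with
  | zero => simp
  | succ k ih =>
    rw [Function.iterate_succ_apply', ih, lap_const_mul _ (trig_smooth _ _), trig_lap]
    funext x; ring

open scoped FourierTransform in
lemma fourier_trig {n : ℕ} {w : E n → ℝ} (hw : Integrable w) (ξ : E n) :
    𝓕 (fun x => (w x : ℂ)) ξ = ((∫ x, w x * trig ((2 * Real.pi) • ξ) 0 x : ℝ) : ℂ)
      + ((∫ x, w x * trig ((2 * Real.pi) • ξ) (Real.pi / 2) x : ℝ) : ℂ) * Complex.I := by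
  have hb : ∀ c, Integrable (fun x => w x * trig ((2 * Real.pi) • ξ) c x) := by
    intro c
    refine hw.mul_bdd (c := 1) (trig_smooth _ _).continuous.aestronglyMeasurable ?_
    filter_upwards with x
    exact Real.abs_cos_le_one _
  rw [Real.fourier_eq', ← integral_complex_ofReal, ← integral_complex_ofReal,
    ← integral_mul_const, ← integral_add (hb _).ofReal ((hb _).ofReal.mul_const _)]
  congr 1
  funext x
  unfold trig
  rw [add_zero, Real.cos_add_pi_div_two, inner_smul_left, real_inner_comm, Complex.exp_mul_I,
    ← Complex.ofReal_cos, ← Complex.ofReal_sin]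
  have : -2 * Real.pi * inner ℝ ξ x = -(2 * Real.pi * inner ℝ ξ x) := by ring
  rw [this, Real.cos_neg, Real.sin_neg]
  simp
  ring

open scoped FourierTransform in
lemma extension {n m : ℕ} (hn : 1 ≤ n) (hm : 1 ≤ m) {x₀ : E n} {w : E n → ℝ}
    (hw : ContDiffOn ℝ (⊤ : ℕ∞) w {x₀}ᶜ) (hc : HasCompactSupport w)
    (ho : w =o[𝓝[≠] x₀] fun x => ‖x - x₀‖ ^ (2 * (m : ℝ) - n))
    {r : ℝ} (hr : 0 < r) (h0 : ∀ x ∈ ball x₀ r, x ≠ x₀ → lap^[m] w x = 0) :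
    ∃ v : E n → ℝ, ContDiff ℝ (⊤ : ℕ∞) v ∧ ∀ x, x ≠ x₀ → v x = w x := by
  classical
  have hwi : Integrable w := w_integrable hn hm hw.continuousOn hc ho
  let f : E n → ℝ := fun x => if x = x₀ then 0 else lap^[m] w x
  have hf : ∀ x, x ≠ x₀ → f x = lap^[m] w x := fun x hx => if_neg hx
  have hf0 : ∀ x ∈ ball x₀ r, f x = 0 := by
    intro x hx
    by_cases h : x = x₀
    · exact if_pos h
    · rw [hf x h, h0 x hx h]
  have hfs : ContDiff ℝ (⊤ : ℕ∞) f := by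
    rw [contDiff_iff_contDiffAt]
    intro x
    by_cases hx : x = x₀
    · have : f =ᶠ[𝓝 x] fun _ => 0 := by
        rw [hx]
        filter_upwards [ball_mem_nhds x₀ hr] with y hy using hf0 y hy
      exact contDiffAt_const.congr_of_eventuallyEq this
    · -- a globally smooth function agreeing with w near x
      have hd : 0 < dist x x₀ / 4 := by have := dist_pos.mpr hx; positivity
      let b : ContDiffBump x₀ := ⟨dist x x₀ / 4, dist x x₀ / 2, hd, by linarith⟩
      let w' : E n → ℝ := fun y => (1 - b y) * w y
      have hw's : ContDiff ℝ (⊤ : ℕ∞) w' := by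
        rw [contDiff_iff_contDiffAt]
        intro y
        by_cases hy : y = x₀
        · have : w' =ᶠ[𝓝 y] fun _ => 0 := by
            rw [hy]
            filter_upwards [ball_mem_nhds x₀ hd] with z hz
            simp only [w', b.one_of_mem_closedBall (ball_subset_closedBall hz)]; ring
          exact contDiffAt_const.congr_of_eventuallyEq this
        · exact (contDiff_const.sub b.contDiff).contDiffAt.mul
            (hw.contDiffAt (isOpen_compl_singleton.mem_nhds hy))
      have e1 : w =ᶠ[𝓝 x] w' := by
        have : {y : E n | dist x x₀ / 2 < dist y x₀} ∈ 𝓝 x :=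
          (isOpen_lt continuous_const (continuous_id.dist continuous_const)).mem_nhds
            (show dist x x₀ / 2 < dist x x₀ by linarith)
        filter_upwards [this] with y hy
        simp only [w', b.zero_of_le_dist (le_of_lt hy)]; ring
      have e2 : f =ᶠ[𝓝 x] lap^[m] w' := by
        filter_upwards [lap_iter_congr m e1, isOpen_compl_singleton.mem_nhds hx] with y hy hy'
        rw [hf y hy', hy]
      exact (lap_iter_smooth m hw's).contDiffAt.congr_of_eventuallyEq e2
  have hfc : HasCompactSupport f := by
    refine HasCompactSupport.intro hc fun x hx => ?_
    by_cases h : x = x₀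
    · exact if_pos h
    · rw [hf x h]; exact lap_iter_eq_zero_of_notMem m hx
  have hfi : Integrable f := hfs.continuous.integrable_of_hasCompactSupport hfc
  let W : E n → ℂ := fun x => (w x : ℂ)
  let F : E n → ℂ := fun x => (f x : ℂ)
  have hWi : Integrable W := hwi.ofReal
  have hFs : ContDiff ℝ (⊤ : ℕ∞) F := Complex.ofRealCLM.contDiff.comp hfs
  have hFc : HasCompactSupport F := hfc.comp_left (g := fun t : ℝ => (t : ℂ)) (by simp)
  let S := hFc.toSchwartzMap hFs
  -- the equation on the Fourier side
  have hweak : ∀ (ζ : E n) (c : ℝ),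
      (-‖ζ‖ ^ 2) ^ m * ∫ x, w x * trig ζ c x = ∫ x, f x * trig ζ c x := by
    intro ζ c
    rw [← weak hn hm hw hc ho hr hf0 hf (trig_smooth ζ c), trig_lap_iter, ← integral_const_mul]
    congr 1; funext x; ring
  have hFT : ∀ ξ : E n, 𝓕 F ξ = (((-‖(2 * Real.pi) • ξ‖ ^ 2) ^ m : ℝ) : ℂ) * 𝓕 W ξ := by
    intro ξ
    rw [fourier_trig hfi, fourier_trig hwi, ← hweak, ← hweak]
    push_cast; ring
  have hle : ∀ ξ : E n, 1 ≤ ‖ξ‖ → ‖𝓕 W ξ‖ ≤ ‖𝓕 F ξ‖ := by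
    intro ξ hξ
    rw [hFT, norm_mul, Complex.norm_real, norm_pow, norm_neg, norm_pow, norm_norm, norm_smul]
    refine le_mul_of_one_le_left (norm_nonneg _) ?_
    refine one_le_pow₀ (one_le_pow₀ ?_)
    have h2 : (1 : ℝ) ≤ ‖2 * Real.pi‖ := by
      rw [Real.norm_of_nonneg (by positivity)]
      linarith [Real.pi_gt_three]
    nlinarith
  have hWcont : Continuous (𝓕 W) := by
    have : ContDiff ℝ ((0 : ℕ∞)) (𝓕 W) := by
      refine Real.contDiff_fourier fun k hk => ?_
      have : k = 0 := by simpa using hk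
      subst this
      simpa using hWi.norm
    exact this.continuous
  obtain ⟨A, hA⟩ := (isCompact_closedBall (0 : E n) 1).exists_bound_of_continuousOn
    hWcont.continuousOn
  have hdecay : ∀ k : ℕ, Integrable (fun ξ : E n => ‖ξ‖ ^ k * ‖𝓕 W ξ‖) := by
    intro k
    have hS : Integrable (fun ξ : E n => ‖ξ‖ ^ k * ‖𝓕 F ξ‖) :=
      SchwartzMap.integrable_pow_mul volume (𝓕 S) k
    have hind : Integrable ((closedBall (0 : E n) 1).indicator (fun _ => A)) :=
      IntegrableOn.integrable_indicator
        (integrableOn_const (by exact measure_closedBall_lt_top.ne)) measurableSet_closedBall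
    refine Integrable.mono' (hind.add hS)
      ((continuous_norm.pow k).mul hWcont.norm).aestronglyMeasurable ?_
    filter_upwards with ξ
    rw [Real.norm_of_nonneg (by positivity), Pi.add_apply]
    by_cases hξ : ξ ∈ closedBall (0 : E n) 1
    · rw [Set.indicator_of_mem hξ]
      have h1 : ‖ξ‖ ^ k ≤ 1 := pow_le_one₀ (norm_nonneg _) (by simpa using hξ)
      have h2 : ‖ξ‖ ^ k * ‖𝓕 W ξ‖ ≤ 1 * A :=
        mul_le_mul h1 (hA ξ hξ) (norm_nonneg _) zero_le_one
      have h3 : 0 ≤ ‖ξ‖ ^ k * ‖𝓕 F ξ‖ := by positivity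
      linarith
    · rw [Set.indicator_of_notMem hξ, zero_add]
      gcongr
      apply hle
      rw [mem_closedBall_zero_iff, not_le] at hξ
      exact hξ.le
  have hFWi : Integrable (𝓕 W) := by
    have := hdecay 0
    simp only [pow_zero, one_mul] at this
    exact (integrable_norm_iff hWcont.aestronglyMeasurable).mp this
  have hVs : ContDiff ℝ (⊤ : ℕ∞) (𝓕⁻ (𝓕 W)) := by
    have h1 : ContDiff ℝ (⊤ : ℕ∞) (𝓕 (𝓕 W)) := Real.contDiff_fourier fun k _ => hdecay k
    have h2 : (𝓕⁻ (𝓕 W)) = fun x => 𝓕 (𝓕 W) (-x) := by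
      funext x; exact Real.fourierInv_eq_fourier_neg _ _
    rw [h2]
    exact h1.comp contDiff_neg
  refine ⟨fun x => (𝓕⁻ (𝓕 W) x).re, Complex.reCLM.contDiff.comp hVs, fun x hx => ?_⟩
  have hcx : ContinuousAt W x :=
    Complex.continuous_ofReal.continuousAt.comp
      (hw.continuousOn.continuousAt (isOpen_compl_singleton.mem_nhds hx))
  have hinv : 𝓕⁻ (𝓕 W) x = W x := hWi.fourierInv_fourier_eq hFWi hcx
  simp only [hinv, W, Complex.ofReal_re]

/-- Theorem 2 (n ≥ 3): if `Δᵐu = 0` on `Ω \ {x₀}` and `|u(x)| = o(|x-x₀|^{2m-n})`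
as `x → x₀`, then `u` has a removable singularity at `x₀`. -/
theorem polyharmonic_removable_of_littleO_u (n m : ℕ) (hn : 3 ≤ n) (hm : 2 ≤ m)
    (Ω : Set (E n)) (hΩ : IsOpen Ω) (hΩc : IsConnected Ω)
    (x₀ : E n) (hx₀ : x₀ ∈ Ω) (u : E n → ℝ)
    (hu : ContDiffOn ℝ (⊤ : ℕ∞) u (Ω \ {x₀}))
    (hpoly : ∀ x ∈ Ω \ {x₀}, lap^[m] u x = 0)
    (ho : u =o[𝓝[≠] x₀] fun x => ‖x - x₀‖ ^ (2 * (m : ℝ) - n)) :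
    ∃ δ > 0, closedBall x₀ δ ⊆ Ω ∧
      ∃ v : E n → ℝ, ContDiffOn ℝ (⊤ : ℕ∞) v (ball x₀ δ) ∧
        (∀ x ∈ ball x₀ δ, lap^[m] v x = 0) ∧
        ∀ x ∈ ball x₀ δ \ {x₀}, u x = v x := by
  obtain ⟨R, hR, hRΩ⟩ := Metric.nhds_basis_closedBall.mem_iff.mp (hΩ.mem_nhds hx₀)
  have hδ : 0 < R / 2 := by positivity
  have hsub : closedBall x₀ (R / 2) ⊆ Ω := (closedBall_subset_closedBall (by linarith)).trans hRΩ
  let χ : ContDiffBump x₀ := ⟨R / 2, R, hδ, by linarith⟩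
  let w : E n → ℝ := fun x => χ x * u x
  have hopen : IsOpen (Ω \ {x₀}) := hΩ.sdiff isClosed_singleton
  have hwu : ∀ x ∈ ball x₀ (R / 2), w x = u x := by
    intro x hx
    simp only [w, χ.one_of_mem_closedBall (ball_subset_closedBall hx), one_mul]
  have hw : ContDiffOn ℝ (⊤ : ℕ∞) w {x₀}ᶜ := by
    intro x hx
    apply ContDiffAt.contDiffWithinAt
    by_cases hxΩ : x ∈ Ω
    · exact χ.contDiff.contDiffAt.mul (hu.contDiffAt (hopen.mem_nhds ⟨hxΩ, hx⟩))
    · have hx' : x ∉ tsupport χ := by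
        rw [χ.tsupport_eq]; exact fun h => hxΩ (hRΩ h)
      have : w =ᶠ[𝓝 x] fun _ => 0 := by
        filter_upwards [notMem_tsupport_iff_eventuallyEq.mp hx'] with y hy
        simp only [w]; rw [hy]; simp
      exact contDiffAt_const.congr_of_eventuallyEq this
  have hc : HasCompactSupport w := χ.hasCompactSupport.mul_right
  have how : w =o[𝓝[≠] x₀] fun x => ‖x - x₀‖ ^ (2 * (m : ℝ) - n) := by
    refine ho.congr' ?_ EventuallyEq.rfl
    filter_upwards [mem_nhdsWithin_of_mem_nhds (ball_mem_nhds x₀ hδ)] with x hx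
    exact (hwu x hx).symm
  have h0 : ∀ x ∈ ball x₀ (R / 2), x ≠ x₀ → lap^[m] w x = 0 := by
    intro x hx hne
    rw [← hpoly x ⟨hsub (ball_subset_closedBall hx), hne⟩]
    refine (lap_iter_congr m ?_).eq_of_nhds
    filter_upwards [isOpen_ball.mem_nhds hx] with y hy using hwu y hy
  obtain ⟨v, hv, hvw⟩ := extension (by omega) (by omega) hw hc how hδ h0
  refine ⟨R / 2, hδ, hsub, v, hv.contDiffOn, ?_, ?_⟩
  · have hoff : ∀ x ∈ ball x₀ (R / 2), x ≠ x₀ → lap^[m] v x = 0 := by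
      intro x hx hne
      rw [← h0 x hx hne]
      refine (lap_iter_congr m ?_).eq_of_nhds
      filter_upwards [isOpen_compl_singleton.mem_nhds hne] with y hy using hvw y hy
    intro x hx
    by_cases hne : x = x₀
    · rw [hne]
      have : Nonempty (Fin n) := ⟨⟨0, by omega⟩⟩
      have : Nontrivial (E n) := inferInstance
      have : (𝓝[≠] x₀).NeBot := Module.punctured_nhds_neBot ℝ (E n) x₀
      have ht : Tendsto (lap^[m] v) (𝓝[≠] x₀) (𝓝 (lap^[m] v x₀)) :=
        ((lap_iter_smooth m hv).continuous.tendsto x₀).mono_left nhdsWithin_le_nhds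
      refine tendsto_nhds_unique_of_eventuallyEq ht tendsto_const_nhds ?_
      filter_upwards [mem_nhdsWithin_of_mem_nhds (ball_mem_nhds x₀ hδ),
        self_mem_nhdsWithin] with y hy hy'
      exact hoff y hy hy'
    · exact hoff x hx hne
  · intro x hx
    rw [hvw x hx.2, hwu x hx.1]
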